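/- arXiv:1407.1994 — 4 statements merged into one kernel-verified Lean document; each statement's English description precedes it below -/
import Mathlib

section
/- Let R : Fin n → Fin n → Fin n → Fin n → ℝ satisfy the symmetries of a Riemann curvature tensor: R μ ν λ ρ = −R ν μ λ ρ, R μ ν λ ρ = −R μ ν ρ λ, R μ ν λ ρ = R λ ρ μ ν, and the first Bianchi identity R μ ν λ ρ + R μ λ ρ ν + R μ ρ ν λ = 0. Then for every index ν one has Σ_{μ,λ,ρ} R μ ν λ ρ • (γ_μ·γ_λ·γ_ρ) = 2·Σ_ρ (Σ_μ R μ ν μ ρ) • γ_ρ. (This is the algebraic content of the spin-curvature identity γ^μ 𝔯_{μν} = ½ γ^μ R_{μν} invoked at the end of the proof of the transport equation lemma for Y_j.) -/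
open Matrix

/-- In a real algebra generated by Euclidean gamma matrices, contracting an array `T` that is
antisymmetric in its last two indices and has vanishing cyclic sum with a triple product of
gamma matrices leaves twice the trace of `T`. -/
theorem sum_smul_clifford_triple {ι A : Type*} [Fintype ι] [DecidableEq ι] [Ring A] [Algebra ℝ A]
    (γ : ι → A) (hγ : ∀ a b, γ a * γ b + γ b * γ a = (if a = b then (2 : ℝ) else 0) • (1 : A))
    (T : ι → ι → ι → ℝ) (hanti : ∀ a b c, T a b c = -T a c b)
    (hcyc : ∀ a b c, T a b c + T b c a + T c a b = 0) :
    ∑ a, ∑ b, ∑ c, T a b c • (γ a * γ b * γ c) = (2 : ℝ) • ∑ c, (∑ a, T a a c) • γ c := by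
  have trace_fst : ∑ a, ∑ b, ∑ c, T a b c • ((if a = b then (2 : ℝ) else 0) • γ c) =
      (2 : ℝ) • ∑ c, (∑ a, T a a c) • γ c := by
    simp only [Finset.sum_smul, Finset.smul_sum]
    conv_rhs => rw [Finset.sum_comm]
    refine Finset.sum_congr rfl fun a _ => ?_
    rw [Finset.sum_comm]
    refine Finset.sum_congr rfl fun c _ => ?_
    simp [ite_smul, smul_ite, smul_comm (2 : ℝ)]
  have swap (f : ι → ι → ι → A) :
      ∑ a, ∑ b, ∑ c, T a b c • f a c b = -∑ a, ∑ b, ∑ c, T a b c • f a b c := by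
    rw [← Finset.sum_neg_distrib]
    refine Finset.sum_congr rfl fun a _ => ?_
    rw [Finset.sum_comm, ← Finset.sum_neg_distrib]
    refine Finset.sum_congr rfl fun b _ => ?_
    rw [← Finset.sum_neg_distrib]
    refine Finset.sum_congr rfl fun c _ => ?_
    rw [hanti a c b, neg_smul]
  have rotate (f : ι → ι → ι → A) :
      ∑ a, ∑ b, ∑ c, f a b c = ∑ a, ∑ b, ∑ c, f b c a := by
    symm
    rw [Finset.sum_comm]
    exact Finset.sum_congr rfl fun a _ => Finset.sum_comm
  have cyclic : ∑ a, ∑ b, ∑ c, T a b c • (γ a * γ b * γ c) +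
      ∑ a, ∑ b, ∑ c, T a b c • (γ c * γ a * γ b) +
      ∑ a, ∑ b, ∑ c, T a b c • (γ b * γ c * γ a) = 0 := by
    rw [rotate fun a b c => T a b c • (γ c * γ a * γ b),
      ← rotate fun a b c => T c a b • (γ a * γ b * γ c)]
    simp only [← Finset.sum_add_distrib, ← add_smul, hcyc, zero_smul, Finset.sum_const_zero]
  have comm (a b : ι) : γ b * γ a = (if a = b then (2 : ℝ) else 0) • (1 : A) - γ a * γ b :=
    eq_sub_of_add_eq' (hγ a b)
  have outer : ∑ a, ∑ b, ∑ c, T a b c • (γ c * γ a * γ b) =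
      ∑ a, ∑ b, ∑ c, T a b c • ((if a = c then (2 : ℝ) else 0) • γ b) -
      ∑ a, ∑ b, ∑ c, T a b c • (γ a * γ c * γ b) := by
    simp only [← Finset.sum_sub_distrib, ← smul_sub]
    refine Finset.sum_congr rfl fun a _ => Finset.sum_congr rfl fun b _ =>
      Finset.sum_congr rfl fun c _ => ?_
    rw [comm a c, sub_mul, smul_mul_assoc, one_mul]
  have inner : ∑ a, ∑ b, ∑ c, T a b c • (γ b * γ c * γ a) =
      ∑ a, ∑ b, ∑ c, T a b c • ((if a = c then (2 : ℝ) else 0) • γ b) -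
      ∑ a, ∑ b, ∑ c, T a b c • ((if a = b then (2 : ℝ) else 0) • γ c) +
      ∑ a, ∑ b, ∑ c, T a b c • (γ a * γ b * γ c) := by
    simp only [← Finset.sum_sub_distrib, ← Finset.sum_add_distrib, ← smul_sub, ← smul_add]
    refine Finset.sum_congr rfl fun a _ => Finset.sum_congr rfl fun b _ =>
      Finset.sum_congr rfl fun c _ => ?_
    congr 1
    rw [mul_assoc, comm a c, mul_sub, mul_smul_comm, mul_one, ← mul_assoc, comm a b, sub_mul,
      smul_mul_assoc, one_mul]
    abel
  rw [outer, inner, swap fun a b c => γ a * γ b * γ c,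
    swap fun a b c => (if a = b then (2 : ℝ) else 0) • γ c, trace_fst] at cyclic
  have triple : (3 : ℝ) • (∑ a, ∑ b, ∑ c, T a b c • (γ a * γ b * γ c) -
      (2 : ℝ) • ∑ c, (∑ a, T a a c) • γ c) = 0 := by
    rw [← cyclic]
    module
  exact sub_eq_zero.mp ((smul_eq_zero_iff_right three_ne_zero).mp triple)

/-- Spin-curvature identity `γ^μ 𝔯_{μν} = ½ γ^μ R_{μν}` in traced algebraic form:
for a tensor `R` with the symmetries of a Riemann curvature tensor,
`Σ_{μ,λ,ρ} R μ ν λ ρ • (γ_μ γ_λ γ_ρ) = 2 Σ_ρ (Σ_μ R μ ν μ ρ) • γ_ρ`. -/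
theorem stmt_5 {n d : ℕ} (hn : 1 ≤ n) (hd : 1 ≤ d)
    (γ : Fin n → Matrix (Fin d) (Fin d) ℂ)
    (hγ : ∀ μ ν, γ μ * γ ν + γ ν * γ μ =
      if μ = ν then (2 : ℂ) • (1 : Matrix (Fin d) (Fin d) ℂ) else 0)
    (R : Fin n → Fin n → Fin n → Fin n → ℝ)
    (hanti1 : ∀ μ ν lam ρ, R μ ν lam ρ = -R ν μ lam ρ)
    (hanti2 : ∀ μ ν lam ρ, R μ ν lam ρ = -R μ ν ρ lam)
    (hsymm : ∀ μ ν lam ρ, R μ ν lam ρ = R lam ρ μ ν)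
    (hbianchi : ∀ μ ν lam ρ, R μ ν lam ρ + R μ lam ρ ν + R μ ρ ν lam = 0)
    (ν : Fin n) :
    ∑ μ, ∑ lam, ∑ ρ, R μ ν lam ρ • (γ μ * γ lam * γ ρ) =
      (2 : ℝ) • ∑ ρ, (∑ μ, R μ ν μ ρ) • γ ρ := by
  refine sum_smul_clifford_triple γ (fun a b => ?_) (fun a b c => R a ν b c)
    (fun a b c => hanti2 a ν b c) fun a b c => ?_
  · rw [hγ]
    split_ifs
    · simp only [two_smul]
    · simp only [zero_smul]
  · linarith [hbianchi ν a b c, hanti1 a ν b c, hanti1 b ν c a, hanti1 c ν a b]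
end

section
/- Let j ≥ 1 and let V_{j−2}, V_{j−1}, V_j : ℝⁿ × ℝⁿ → Matrix (Fin d) (Fin d) ℂ be smooth functions satisfying the flat-space Hadamard transport equations of orders j − 1 and j (with V_{−1} = 0 when j = 1). Then Y_j satisfies the transport equation of order shifted by one: −2·Σ_μ (x_μ − x'_μ)·(∇_μ Y_j)(x,x') − 2(j−1)·Y_j(x,x') = 2j·(P Y_{j−1})(x,x') for all x, x' ∈ ℝⁿ, where Y_{j−1} is defined from V_{j−1} and V_{j−2} by the same formula. (This is the flat-metric, arbitrary-gauge-background case of the paper's Lemma stating that the sections Y_j = ½ Γ_μ[γ^μ, V_j] + 2j(𝐷 − 𝐷'^*)V_{j−1} fulfill the transport equation Γ_μ∇^μY_j − (½□Γ − n + 2(j−1))Y_j − 2jPY_{j−1} = 0.) -/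
attribute [local instance] Matrix.normedAddCommGroup Matrix.normedSpace

namespace FlatChiral

/-- Points of flat space `ℝⁿ`. -/
abbrev Pt (n : ℕ) := Fin n → ℝ

/-- Complex `d × d` matrices. -/
abbrev MatC (d : ℕ) := Matrix (Fin d) (Fin d) ℂ

/-- The diagonal entries of the Minkowski metric `η = diag(−1, 1, …, 1)`. -/
def eta {n : ℕ} (μ : Fin n) : ℝ := if (μ : ℕ) = 0 then -1 else 1

/-- Partial derivative `∂_{x_μ}` in the first variable. -/
noncomputable def pd1 {n d : ℕ} (V : Pt n × Pt n → MatC d) (μ : Fin n) (p : Pt n × Pt n) :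
    MatC d :=
  fderiv ℝ V p (Pi.single μ 1, 0)

/-- Partial derivative `∂_{x'_μ}` in the second variable. -/
noncomputable def pd2 {n d : ℕ} (V : Pt n × Pt n → MatC d) (μ : Fin n) (p : Pt n × Pt n) :
    MatC d :=
  fderiv ℝ V p (0, Pi.single μ 1)

/-- Covariant derivative `∇_μ` in the first variable:
`(∇_μ V)(x,x') = ∂_{x_μ}V(x,x') + A_μ(x) V(x,x')`. -/
noncomputable def cd {n d : ℕ} (A : Fin n → Pt n → MatC d) (μ : Fin n)
    (V : Pt n × Pt n → MatC d) : Pt n × Pt n → MatC d :=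
  fun p => pd1 V μ p + A μ p.1 * V p

/-- Field strength `F_{μν} = ∂_μ A_ν − ∂_ν A_μ + A_μ A_ν − A_ν A_μ`. -/
noncomputable def fieldStrength {n d : ℕ} (A : Fin n → Pt n → MatC d) (μ ν : Fin n)
    (x : Pt n) : MatC d :=
  fderiv ℝ (A ν) x (Pi.single μ 1) - fderiv ℝ (A μ) x (Pi.single ν 1) +
    A μ x * A ν x - A ν x * A μ x

/-- The normally hyperbolic operator
`P V = −Σ_μ η^{μμ} ∇_μ∇_μ V − ¼ Σ_{μ,ν} η^{μμ}η^{νν} F_{μν}(x) (γ_μγ_ν − γ_νγ_μ) V`. -/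
noncomputable def opP {n d : ℕ} (γ : Fin n → MatC d) (A : Fin n → Pt n → MatC d)
    (V : Pt n × Pt n → MatC d) : Pt n × Pt n → MatC d :=
  fun p =>
    -(∑ μ, eta μ • cd A μ (cd A μ V) p) -
      (1 / 4 : ℂ) • ∑ μ, ∑ ν, (eta μ * eta ν) •
        (fieldStrength A μ ν p.1 * (γ μ * γ ν - γ ν * γ μ) * V p)

/-- The Dirac operator in the first variable:
`(𝐷 V)(x,x') = Σ_μ η^{μμ} γ_μ (∂_{x_μ}V + A_μ(x) V)`. -/
noncomputable def dirac {n d : ℕ} (γ : Fin n → MatC d) (A : Fin n → Pt n → MatC d)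
    (V : Pt n × Pt n → MatC d) : Pt n × Pt n → MatC d :=
  fun p => ∑ μ, eta μ • (γ μ * (pd1 V μ p + A μ p.1 * V p))

/-- The adjoint Dirac operator acting from the right in the second variable:
`(𝐷'^* V)(x,x') = −Σ_μ η^{μμ} (∂_{x'_μ}V − V A_μ(x')) γ_μ`. -/
noncomputable def diracAdj {n d : ℕ} (γ : Fin n → MatC d) (A : Fin n → Pt n → MatC d)
    (V : Pt n × Pt n → MatC d) : Pt n × Pt n → MatC d :=
  fun p => -∑ μ, eta μ • ((pd2 V μ p - V p * A μ p.2) * γ μ)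

/-- The flat-space Hadamard transport equation of order `k`:
`−2 Σ_μ (x_μ − x'_μ)(∇_μ V_k) − 2k V_k = 2k (P V_{k−1})`. -/
def TransportEq {n d : ℕ} (γ : Fin n → MatC d) (A : Fin n → Pt n → MatC d) (k : ℕ)
    (Vk Vkm : Pt n × Pt n → MatC d) : Prop :=
  ∀ p : Pt n × Pt n,
    (-2 : ℝ) • ∑ μ, (p.1 μ - p.2 μ) • cd A μ Vk p - (2 * (k : ℝ)) • Vk p =
      (2 * (k : ℝ)) • opP γ A Vkm p

/-- The section `Y_k = ½ Γ_μ [γ^μ, V_k] + 2k (𝐷 − 𝐷'^*) V_{k−1}` in the flat metric: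
`Y_k(x,x') = −Σ_μ (x_μ − x'_μ)(γ_μ V_k − V_k γ_μ) + 2k ((𝐷 − 𝐷'^*)V_{k−1})(x,x')`. -/
noncomputable def Ysec {n d : ℕ} (γ : Fin n → MatC d) (A : Fin n → Pt n → MatC d) (k : ℕ)
    (Vk Vkm : Pt n × Pt n → MatC d) : Pt n × Pt n → MatC d :=
  fun p =>
    -(∑ μ, (p.1 μ - p.2 μ) • (γ μ * Vk p - Vk p * γ μ)) +
      (2 * (k : ℝ)) • (dirac γ A Vkm p - diracAdj γ A Vkm p)

section Abstract

variable {ι R : Type*} [Fintype ι] [Ring R] [Algebra ℝ R]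

/-- The Clifford contraction `∑ η_μ γ_μ a_μ`. -/
def contract (η : ι → ℝ) (L N : ι → R) : R := ∑ μ, η μ • (L μ * N μ)

/-- If `D = ∑ η γ_μ ∇_μ` and `S = ∑ γ_μ x_μ`, then `D S + S D = n + 2 ∑ x_μ ∇_μ`. -/
theorem contract_anticomm_position [DecidableEq ι] {η : ι → ℝ} (hη : ∀ μ, η μ * η μ = 1) {L N X : ι → R}
    (hL : ∀ μ ν, L μ * L ν + L ν * L μ = if μ = ν then ((2 : ℝ) * η μ) • (1 : R) else 0)
    (hNL : ∀ μ ν, N μ * L ν = L ν * N μ) (hXL : ∀ μ ν, X μ * L ν = L ν * X μ)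
    (hNX : ∀ μ ν, N μ * X ν = X ν * N μ + if μ = ν then 1 else 0) :
    contract η L N * (∑ ν, L ν * X ν) + (∑ ν, L ν * X ν) * contract η L N =
      (Fintype.card ι : ℝ) • (1 : R) + (2 : ℝ) • ∑ μ, X μ * N μ := by
  have hsq : ∀ μ, η μ • (L μ * L μ) = 1 := fun μ => by
    have h : L μ * L μ = η μ • (1 : R) := by
      have h := hL μ μ
      rw [if_pos rfl] at h
      linear_combination (norm := module) (1 / 2 : ℝ) • h
    rw [h, smul_smul, hη, one_smul]
  have key : ∀ μ ν, η μ • (L μ * N μ) * (L ν * X ν) + L ν * X ν * η μ • (L μ * N μ) =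
      if μ = ν then (1 : R) + (2 : ℝ) • (X μ * N μ) else 0 := fun μ ν => by
    have e1 : L μ * N μ * (L ν * X ν) =
        L μ * L ν * (X ν * N μ) + L μ * L ν * (if μ = ν then 1 else 0) := by
      rw [← mul_add, ← hNX, mul_assoc, ← mul_assoc (N μ), hNL]; noncomm_ring
    have e2 : L ν * X ν * (L μ * N μ) = L ν * L μ * (X ν * N μ) := by
      rw [mul_assoc, ← mul_assoc (X ν), hXL]; noncomm_ring
    rw [smul_mul_assoc, mul_smul_comm, e1, e2, ← smul_add, add_right_comm, ← add_mul, hL]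
    split_ifs with h
    · subst h
      rw [mul_one, smul_add, hsq, smul_mul_assoc, smul_smul, one_mul,
        show η μ * (2 * η μ) = 2 by linear_combination 2 * hη μ, add_comm]
    · simp
  simp only [contract, Finset.sum_mul_sum]
  rw [Finset.sum_comm (s := Finset.univ) (t := Finset.univ)
    (f := fun ν μ => L ν * X ν * η μ • (L μ * N μ)), ← Finset.sum_add_distrib]
  simp only [← Finset.sum_add_distrib, key, Finset.sum_ite_eq, Finset.mem_univ, if_true]
  simp [Finset.sum_add_distrib, Finset.smul_sum, Nat.cast_smul_eq_nsmul]

/-- The Euler operator reproduces an operator linear in position. -/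
theorem euler_mul_position {ι R : Type*} [Fintype ι] [DecidableEq ι] [Ring R] {L N X : ι → R}
    (hNL : ∀ μ ν, N μ * L ν = L ν * N μ) (hXL : ∀ μ ν, X μ * L ν = L ν * X μ)
    (hXX : ∀ μ ν, X μ * X ν = X ν * X μ)
    (hNX : ∀ μ ν, N μ * X ν = X ν * N μ + if μ = ν then 1 else 0) :
    (∑ μ, X μ * N μ) * (∑ ν, L ν * X ν) =
      (∑ ν, L ν * X ν) * (∑ μ, X μ * N μ) + ∑ ν, L ν * X ν := by
  have key : ∀ μ ν, X μ * N μ * (L ν * X ν) =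
      L ν * X ν * (X μ * N μ) + if μ = ν then L μ * X μ else 0 := fun μ ν => by
    calc X μ * N μ * (L ν * X ν) = X μ * (N μ * L ν) * X ν := by noncomm_ring
      _ = (X μ * L ν) * (N μ * X ν) := by rw [hNL]; noncomm_ring
      _ = L ν * (X μ * X ν) * N μ + L ν * X μ * (if μ = ν then 1 else 0) := by
        rw [hXL, hNX]; noncomm_ring
      _ = _ := by
        rw [hXX]
        split_ifs with h
        · subst h; noncomm_ring
        · noncomm_ring
  simp only [Finset.sum_mul_sum, key, Finset.sum_add_distrib, Finset.sum_ite_eq,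
    Finset.mem_univ, if_true]
  rw [Finset.sum_comm]

/-- `[D, ∑ γ'_μ x_μ] = ∑ η γ_μ γ'_μ` for `γ'` commuting with everything. -/
theorem contract_mul_position [DecidableEq ι] {η : ι → ℝ} {L N X Q : ι → R}
    (hNQ : ∀ μ ν, N μ * Q ν = Q ν * N μ) (hLQ : ∀ μ ν, L μ * Q ν = Q ν * L μ)
    (hXL : ∀ μ ν, X μ * L ν = L ν * X μ)
    (hNX : ∀ μ ν, N μ * X ν = X ν * N μ + if μ = ν then 1 else 0) :
    contract η L N * (∑ ν, Q ν * X ν) =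
      (∑ ν, Q ν * X ν) * contract η L N + contract η L Q := by
  have key : ∀ μ ν, η μ • (L μ * N μ) * (Q ν * X ν) =
      Q ν * X ν * η μ • (L μ * N μ) + if μ = ν then η μ • (L μ * Q μ) else 0 := fun μ ν => by
    have e : L μ * N μ * (Q ν * X ν) =
        Q ν * X ν * (L μ * N μ) + if μ = ν then L μ * Q μ else 0 := by
      calc L μ * N μ * (Q ν * X ν) = L μ * (N μ * Q ν) * X ν := by noncomm_ring
        _ = L μ * Q ν * (N μ * X ν) := by rw [hNQ]; noncomm_ring
        _ = (L μ * Q ν) * X ν * N μ + L μ * Q ν * (if μ = ν then 1 else 0) := by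
          rw [hNX]; noncomm_ring
        _ = Q ν * (L μ * X ν) * N μ + L μ * Q ν * (if μ = ν then 1 else 0) := by
          rw [hLQ]; noncomm_ring
        _ = _ := by
          rw [← hXL]
          split_ifs with h
          · subst h; noncomm_ring
          · noncomm_ring
    rw [smul_mul_assoc, mul_smul_comm, e, smul_add]
    split_ifs <;> simp
  simp only [contract, Finset.sum_mul_sum, key, Finset.sum_add_distrib, Finset.sum_ite_eq,
    Finset.mem_univ, if_true]
  rw [Finset.sum_comm]

/-- The anticommutator of `D` with `∑ η γ_μ γ'_μ` is `2 ∑ η γ'_μ ∇_μ`. -/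
theorem contract_anticomm_contract [DecidableEq ι] {η : ι → ℝ} (hη : ∀ μ, η μ * η μ = 1) {L N Q : ι → R}
    (hL : ∀ μ ν, L μ * L ν + L ν * L μ = if μ = ν then ((2 : ℝ) * η μ) • (1 : R) else 0)
    (hNL : ∀ μ ν, N μ * L ν = L ν * N μ)
    (hNQ : ∀ μ ν, N μ * Q ν = Q ν * N μ) (hLQ : ∀ μ ν, L μ * Q ν = Q ν * L μ) :
    contract η L N * contract η L Q + contract η L Q * contract η L N =
      (2 : ℝ) • contract η Q N := by
  have key : ∀ μ ν, η μ • (L μ * N μ) * η ν • (L ν * Q ν) +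
      η ν • (L ν * Q ν) * η μ • (L μ * N μ) =
      if μ = ν then (2 : ℝ) • η μ • (Q μ * N μ) else 0 := fun μ ν => by
    have e1 : L μ * N μ * (L ν * Q ν) = L μ * L ν * (Q ν * N μ) := by
      rw [← hNQ, mul_assoc, ← mul_assoc (N μ), hNL]; noncomm_ring
    have e2 : L ν * Q ν * (L μ * N μ) = L ν * L μ * (Q ν * N μ) := by
      rw [mul_assoc, ← mul_assoc (Q ν), ← hLQ]; noncomm_ring
    simp only [smul_mul_assoc, mul_smul_comm]
    rw [e1, e2, smul_comm (η ν), ← smul_add, ← smul_add, ← add_mul, hL]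
    split_ifs with h
    · subst h
      rw [smul_mul_assoc, one_mul, smul_smul, smul_smul, smul_smul]
      congr 1
      linear_combination 2 * η μ * hη μ
    · simp
  simp only [contract, Finset.sum_mul_sum]
  rw [Finset.sum_comm (s := Finset.univ) (t := Finset.univ)
    (f := fun ν μ => η ν • (L ν * Q ν) * η μ • (L μ * N μ)), ← Finset.sum_add_distrib]
  simp only [← Finset.sum_add_distrib, key, Finset.sum_ite_eq, Finset.mem_univ, if_true,
    Finset.smul_sum]

/-- Commutator of the Euler operator with a contraction of derivatives in the second variable. -/
theorem contract_mul_euler [DecidableEq ι] {η : ι → ℝ} {N N' X Q : ι → R}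
    (hNQ : ∀ μ ν, N μ * Q ν = Q ν * N μ) (hXQ : ∀ μ ν, X μ * Q ν = Q ν * X μ)
    (hNN' : ∀ μ ν, N μ * N' ν = N' ν * N μ)
    (hN'X : ∀ μ ν, N' μ * X ν = X ν * N' μ - if μ = ν then 1 else 0) :
    (∑ μ, X μ * N μ) * contract η Q N' =
      contract η Q N' * (∑ μ, X μ * N μ) + contract η Q N := by
  have key : ∀ μ ν, X μ * N μ * η ν • (Q ν * N' ν) =
      η ν • (Q ν * N' ν) * (X μ * N μ) + if μ = ν then η μ • (Q μ * N μ) else 0 := fun μ ν => by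
    have e : X μ * N μ * (Q ν * N' ν) =
        Q ν * N' ν * (X μ * N μ) + if μ = ν then Q μ * N μ else 0 := by
      have hx : X μ * N' ν = N' ν * X μ + if μ = ν then 1 else 0 := by
        rw [hN'X]; simp [eq_comm]
      calc X μ * N μ * (Q ν * N' ν) = X μ * (N μ * Q ν) * N' ν := by noncomm_ring
        _ = (X μ * Q ν) * (N μ * N' ν) := by rw [hNQ]; noncomm_ring
        _ = Q ν * (X μ * N' ν) * N μ := by rw [hXQ, hNN']; noncomm_ring
        _ = _ := by
          rw [hx]
          split_ifs with h
          · subst h; noncomm_ring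
          · noncomm_ring
    rw [smul_mul_assoc, mul_smul_comm, e, smul_add]
    split_ifs <;> simp_all
  simp only [contract, Finset.sum_mul_sum, key, Finset.sum_add_distrib, Finset.sum_ite_eq,
    Finset.mem_univ, if_true]
  rw [Finset.sum_comm]

theorem contract_commute_contract {η : ι → ℝ} {L N N' Q : ι → R}
    (hNQ : ∀ μ ν, N μ * Q ν = Q ν * N μ) (hLQ : ∀ μ ν, L μ * Q ν = Q ν * L μ)
    (hNN' : ∀ μ ν, N μ * N' ν = N' ν * N μ) (hN'L : ∀ μ ν, N' μ * L ν = L ν * N' μ) :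
    contract η L N * contract η Q N' = contract η Q N' * contract η L N := by
  refine Commute.sum_left _ _ _ fun μ _ => Commute.sum_right _ _ _ fun ν _ => ?_
  refine Commute.smul_left (Commute.smul_right ?_ _) _
  exact ((show Commute (L μ) (Q ν) from hLQ μ ν).mul_right (hN'L ν μ).symm).mul_left
    ((show Commute (N μ) (Q ν) from hNQ μ ν).mul_right (hNN' μ ν))

/-- Weitzenböck formula. -/
theorem contract_sq [DecidableEq ι] {η : ι → ℝ} (hη : ∀ μ, η μ * η μ = 1) {L N : ι → R}
    (hL : ∀ μ ν, L μ * L ν + L ν * L μ = if μ = ν then ((2 : ℝ) * η μ) • (1 : R) else 0)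
    (hNL : ∀ μ ν, N μ * L ν = L ν * N μ) :
    contract η L N * contract η L N =
      ∑ μ, η μ • (N μ * N μ) + (1 / 4 : ℝ) • ∑ μ, ∑ ν, (η μ * η ν) •
        ((N μ * N ν - N ν * N μ) * (L μ * L ν - L ν * L μ)) := by
  have hP : ∀ μ ν, L μ * N μ * (L ν * N ν) = N μ * N ν * (L μ * L ν) := fun μ ν => by
    calc L μ * N μ * (L ν * N ν) = (L μ * (N μ * L ν)) * N ν := by noncomm_ring
      _ = L μ * (L ν * N μ) * N ν := by rw [hNL]
      _ = L μ * (L ν * (N μ * N ν)) := by noncomm_ring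
      _ = _ := by
        have h1 : Commute (N μ * N ν) (L μ * L ν) :=
          (Commute.mul_left (hNL μ μ) (hNL ν μ)).mul_right (Commute.mul_left (hNL μ ν) (hNL ν ν))
        rw [h1.eq]; noncomm_ring
  have hdiag : ∑ μ, η μ • (N μ * N μ) = ∑ μ, ∑ ν, ((1 / 2 : ℝ) * (η μ * η ν)) •
      (N μ * N ν * (L μ * L ν + L ν * L μ)) := by
    refine Finset.sum_congr rfl fun μ _ => ?_
    simp only [hL, mul_ite, mul_zero, smul_ite, smul_zero, Finset.sum_ite_eq,
      Finset.mem_univ, if_true, mul_smul_comm, mul_one, smul_smul]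
    congr 1
    linear_combination -η μ * hη μ
  have hswap : ∑ μ, ∑ ν, (η μ * η ν) • (N ν * N μ * (L μ * L ν - L ν * L μ)) =
      -∑ μ, ∑ ν, (η μ * η ν) • (N μ * N ν * (L μ * L ν - L ν * L μ)) := by
    rw [Finset.sum_comm]
    simp only [← Finset.sum_neg_distrib]
    refine Finset.sum_congr rfl fun μ _ => Finset.sum_congr rfl fun ν _ => ?_
    rw [← smul_neg, mul_comm (η ν)]
    congr 1
    noncomm_ring
  have hF : ∑ μ, ∑ ν, (η μ * η ν) • ((N μ * N ν - N ν * N μ) * (L μ * L ν - L ν * L μ)) =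
      (2 : ℝ) • ∑ μ, ∑ ν, (η μ * η ν) • (N μ * N ν * (L μ * L ν - L ν * L μ)) := by
    simp only [sub_mul (N _ * N _), smul_sub, Finset.sum_sub_distrib]
    simp only [← smul_sub, ← Finset.sum_sub_distrib] at hswap ⊢
    simp only [smul_sub (η _ * η _) (N _ * N _ * _) (N _ * N _ * _), Finset.sum_sub_distrib, hswap]
    module
  rw [hF, hdiag, smul_smul]
  simp only [contract, Finset.sum_mul_sum, Finset.smul_sum, ← Finset.sum_add_distrib]
  refine Finset.sum_congr rfl fun μ _ => Finset.sum_congr rfl fun ν _ => ?_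
  simp only [smul_mul_assoc, mul_smul_comm, hP, mul_add, mul_sub]
  module

/-- The shift property of the transport equations, in terms of operator relations. -/
theorem transport_shift {M : Type*} [AddCommGroup M] [Module ℝ M]
    {E S T D Q B K P : Module.End ℝ M} (m c : ℝ)
    (hDS : D * S + S * D = m • (1 : Module.End ℝ M) + (2 : ℝ) • E)
    (hES : E * S = S * E + S) (hET : E * T = T * E + T) (hDT : D * T = T * D + K)
    (hDK : D * K + K * D = (2 : ℝ) • B) (hEQ : E * Q = Q * E - B) (hDQ : D * Q = Q * D)
    (hP : P = -(D * D)) {u w v : M}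
    (h1 : (-2 : ℝ) • E w - (2 * (c - 1)) • w = (2 * (c - 1)) • P u)
    (h2 : (-2 : ℝ) • E v - (2 * c) • v = (2 * c) • P w) :
    (-2 : ℝ) • E (-(S v - T v) + (2 * c) • (D w - Q w)) -
        (2 * (c - 1)) • (-(S v - T v) + (2 * c) • (D w - Q w)) =
      (2 * c) • P (-(S w - T w) + (2 * (c - 1)) • (D u - Q u)) := by
  subst hP
  have hcS : D * D * S - S * (D * D) = (2 : ℝ) • (D * E - E * D) := by
    have e : D * D * S - S * (D * D) = D * (D * S + S * D) - (D * S + S * D) * D := by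
      noncomm_ring
    rw [e, hDS]
    simp only [mul_add, add_mul, mul_smul_comm, smul_mul_assoc, mul_one, one_mul]
    module
  have hcT : D * D * T - T * (D * D) = (2 : ℝ) • B := by
    rw [← hDK, mul_assoc D D T, hDT, mul_add, ← mul_assoc, hDT]; noncomm_ring
  have hcQ : D * D * Q = Q * (D * D) := by
    rw [mul_assoc, hDQ, ← mul_assoc, hDQ, mul_assoc]
  have a1 := congrArg S h2
  have a2 := congrArg T h2
  have a3 := congrArg D h1
  have a4 := congrArg Q h1
  have b1 := LinearMap.congr_fun hcS w
  have b2 := LinearMap.congr_fun hcT w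
  have b3 := LinearMap.congr_fun hcQ u
  have b4 := LinearMap.congr_fun hES v
  have b5 := LinearMap.congr_fun hET v
  have b6 := LinearMap.congr_fun hEQ w
  simp only [LinearMap.add_apply, LinearMap.sub_apply, LinearMap.smul_apply, LinearMap.neg_apply,
    Module.End.mul_apply, map_add, map_sub, map_smul, map_neg] at a1 a2 a3 a4 b1 b2 b3 b4 b5 b6 ⊢
  linear_combination (norm := module) (2 : ℝ) • b4 - (2 : ℝ) • b5 + (4 * c) • b6 - a1 + a2 +
    (2 * c) • a3 - (2 * c) • a4 - (2 * c) • b1 + (2 * c) • b2 - (4 * c * (c - 1)) • b3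

end Abstract

section Operators

variable {n d : ℕ}

/-- Matrix multiplication as a continuous bilinear map. -/
noncomputable def mulCLM (d : ℕ) : MatC d →L[ℝ] MatC d →L[ℝ] MatC d :=
  LinearMap.toContinuousLinearMap
    ((LinearMap.toContinuousLinearMap (𝕜 := ℝ) (E := MatC d) (F' := MatC d)).toLinearMap ∘ₗ
      LinearMap.mul ℝ (MatC d))

theorem contDiff_matMul {f g : Pt n × Pt n → MatC d} (hf : ContDiff ℝ (⊤ : ℕ∞) f)
    (hg : ContDiff ℝ (⊤ : ℕ∞) g) : ContDiff ℝ (⊤ : ℕ∞) fun p => f p * g p :=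
  (mulCLM d).isBoundedBilinearMap.contDiff.comp (hf.prodMk hg)

theorem fderiv_matMul_apply {f g : Pt n × Pt n → MatC d} (hf : ContDiff ℝ (⊤ : ℕ∞) f)
    (hg : ContDiff ℝ (⊤ : ℕ∞) g) (p v : Pt n × Pt n) :
    fderiv ℝ (fun p => f p * g p) p v = fderiv ℝ f p v * g p + f p * fderiv ℝ g p v := by
  have h := (mulCLM d).hasFDerivAt_of_bilinear (hf.differentiable (by simp) p).hasFDerivAt
    (hg.differentiable (by simp) p).hasFDerivAt
  have h' : HasFDerivAt (fun p => f p * g p) _ p := h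
  rw [h'.fderiv]
  exact add_comm _ _

/-- Smooth matrix-valued functions of two points. -/
@[ext]
structure SmoothFun (n d : ℕ) where
  /-- The underlying function. -/
  val : Pt n × Pt n → MatC d
  contDiff_val : ContDiff ℝ (⊤ : ℕ∞) val

namespace SmoothFun

instance : Zero (SmoothFun n d) := ⟨⟨fun _ => 0, contDiff_const⟩⟩

instance : Add (SmoothFun n d) := ⟨fun f g => ⟨fun p => f.1 p + g.1 p, f.2.add g.2⟩⟩

instance : Neg (SmoothFun n d) := ⟨fun f => ⟨fun p => -f.1 p, f.2.neg⟩⟩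

instance : Sub (SmoothFun n d) := ⟨fun f g => ⟨fun p => f.1 p - g.1 p, f.2.sub g.2⟩⟩

noncomputable instance : SMul ℝ (SmoothFun n d) := ⟨fun c f => ⟨fun p => c • f.1 p, f.2.const_smul c⟩⟩

instance : AddCommGroup (SmoothFun n d) where
  add_assoc _ _ _ := SmoothFun.ext <| funext fun _ => add_assoc _ _ _
  zero_add _ := SmoothFun.ext <| funext fun _ => zero_add _
  add_zero _ := SmoothFun.ext <| funext fun _ => add_zero _
  add_comm _ _ := SmoothFun.ext <| funext fun _ => add_comm _ _
  neg_add_cancel _ := SmoothFun.ext <| funext fun _ => neg_add_cancel _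
  sub_eq_add_neg _ _ := SmoothFun.ext <| funext fun _ => sub_eq_add_neg _ _
  nsmul := nsmulRec
  zsmul := zsmulRec

noncomputable instance : Module ℝ (SmoothFun n d) where
  one_smul _ := SmoothFun.ext <| funext fun _ => one_smul _ _
  mul_smul _ _ _ := SmoothFun.ext <| funext fun _ => mul_smul _ _ _
  smul_zero _ := SmoothFun.ext <| funext fun _ => smul_zero _
  zero_smul _ := SmoothFun.ext <| funext fun _ => zero_smul _ _
  smul_add _ _ _ := SmoothFun.ext <| funext fun _ => smul_add _ _ _
  add_smul _ _ _ := SmoothFun.ext <| funext fun _ => add_smul _ _ _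

@[simp]
theorem val_zero (p : Pt n × Pt n) : (0 : SmoothFun n d).1 p = 0 := rfl

@[simp]
theorem val_smul (c : ℝ) (f : SmoothFun n d) (p : Pt n × Pt n) : (c • f).1 p = c • f.1 p := rfl

/-- Evaluation at a point. -/
noncomputable def evalAt (p : Pt n × Pt n) : SmoothFun n d →ₗ[ℝ] MatC d where
  toFun f := f.1 p
  map_add' _ _ := rfl
  map_smul' _ _ := rfl

end SmoothFun

/-- Directional derivative as an operator on smooth functions. -/
noncomputable def dirDeriv (v : Pt n × Pt n) : Module.End ℝ (SmoothFun n d) where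
  toFun f := ⟨fun p => fderiv ℝ f.1 p v,
    (f.2.fderiv_right (m := (⊤ : ℕ∞)) (by simp)).clm_apply contDiff_const⟩
  map_add' f g := SmoothFun.ext <| funext fun p => DFunLike.congr_fun
    (fderiv_add (f.2.differentiable (by simp) p) (g.2.differentiable (by simp) p)) v
  map_smul' c f := SmoothFun.ext <| funext fun p => DFunLike.congr_fun
    (fderiv_const_smul (f.2.differentiable (by simp) p) c) v

/-- Multiplication from the left by a smooth function. -/
def lmul (a : SmoothFun n d) : Module.End ℝ (SmoothFun n d) where
  toFun f := ⟨fun p => a.1 p * f.1 p, contDiff_matMul a.2 f.2⟩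
  map_add' f g := SmoothFun.ext <| funext fun p => mul_add (a.1 p) (f.1 p) (g.1 p)
  map_smul' c f := SmoothFun.ext <| funext fun p => mul_smul_comm c (a.1 p) (f.1 p)

/-- Multiplication from the right by a smooth function. -/
def rmul (a : SmoothFun n d) : Module.End ℝ (SmoothFun n d) where
  toFun f := ⟨fun p => f.1 p * a.1 p, contDiff_matMul f.2 a.2⟩
  map_add' f g := SmoothFun.ext <| funext fun p => add_mul (f.1 p) (g.1 p) (a.1 p)
  map_smul' c f := SmoothFun.ext <| funext fun p => smul_mul_assoc c (f.1 p) (a.1 p)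

theorem dirDeriv_apply (v : Pt n × Pt n) (f : SmoothFun n d) (p : Pt n × Pt n) :
    (dirDeriv v f).1 p = fderiv ℝ f.1 p v := rfl

theorem lmul_apply (a f : SmoothFun n d) (p : Pt n × Pt n) : (lmul a f).1 p = a.1 p * f.1 p := rfl

theorem rmul_apply (a f : SmoothFun n d) (p : Pt n × Pt n) : (rmul a f).1 p = f.1 p * a.1 p := rfl

theorem dirDeriv_mul_lmul (v : Pt n × Pt n) (a : SmoothFun n d) :
    dirDeriv v * lmul a = lmul a * dirDeriv v + lmul (dirDeriv v a) := by
  refine LinearMap.ext fun f => SmoothFun.ext <| funext fun p => ?_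
  exact (fderiv_matMul_apply a.2 f.2 p v).trans (add_comm _ _)

theorem dirDeriv_mul_rmul (v : Pt n × Pt n) (a : SmoothFun n d) :
    dirDeriv v * rmul a = rmul a * dirDeriv v + rmul (dirDeriv v a) := by
  refine LinearMap.ext fun f => SmoothFun.ext <| funext fun p => ?_
  exact fderiv_matMul_apply f.2 a.2 p v

theorem dirDeriv_comm (v w : Pt n × Pt n) :
    (dirDeriv v * dirDeriv w : Module.End ℝ (SmoothFun n d)) = dirDeriv w * dirDeriv v := by
  refine LinearMap.ext fun f => SmoothFun.ext <| funext fun p => ?_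
  have hd : DifferentiableAt ℝ (fderiv ℝ f.1) p :=
    (f.2.fderiv_right (m := (⊤ : ℕ∞)) (by simp)).differentiable (by simp) p
  have key : ∀ v w : Pt n × Pt n, fderiv ℝ (fun q => fderiv ℝ f.1 q w) p v =
      fderiv ℝ (fderiv ℝ f.1) p v w := fun v w => by
    have h := (ContinuousLinearMap.apply ℝ (MatC d) w).hasFDerivAt.comp p hd.hasFDerivAt
    have h' : HasFDerivAt (fun q => fderiv ℝ f.1 q w) _ p := h
    rw [h'.fderiv]
    rfl
  have hs : IsSymmSndFDerivAt ℝ f.1 p :=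
    ContDiffAt.isSymmSndFDerivAt (n := (⊤ : ℕ∞)) f.2.contDiffAt (by
      simpa using WithTop.coe_le_coe.2 (le_top : (2 : ℕ∞) ≤ ⊤))
  exact (key v w).trans ((hs.eq v w).trans (key w v).symm)

theorem lmul_mul_rmul (a b : SmoothFun n d) : lmul a * rmul b = rmul b * lmul a :=
  LinearMap.ext fun _ => SmoothFun.ext <| funext fun _ => (mul_assoc _ _ _).symm

theorem lmul_mul_lmul (a b : SmoothFun n d) : lmul a * lmul b = lmul (lmul a b) :=
  LinearMap.ext fun _ => SmoothFun.ext <| funext fun _ => (mul_assoc _ _ _).symm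

theorem lmul_comm {a b : SmoothFun n d} (h : ∀ p, a.1 p * b.1 p = b.1 p * a.1 p) :
    lmul a * lmul b = lmul b * lmul a := by
  rw [lmul_mul_lmul, lmul_mul_lmul]
  exact congrArg lmul (SmoothFun.ext (funext h))

/-- A constant matrix as a smooth function. -/
def constFun (n : ℕ) {d : ℕ} (a : MatC d) : SmoothFun n d := ⟨fun _ => a, contDiff_const⟩

theorem dirDeriv_constFun (v : Pt n × Pt n) (a : MatC d) : dirDeriv v (constFun n a) = 0 :=
  SmoothFun.ext <| funext fun p => by simp [dirDeriv_apply, constFun]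

/-- The scalar function `x_μ − x'_μ`. -/
noncomputable def displacement (d : ℕ) (μ : Fin n) : SmoothFun n d :=
  ⟨fun p => (p.1 μ - p.2 μ) • (1 : MatC d),
    ContDiff.smul (f := fun p : Pt n × Pt n => p.1 μ - p.2 μ) (g := fun _ => (1 : MatC d))
      (by fun_prop) contDiff_const⟩

theorem dirDeriv_displacement (v : Pt n × Pt n) (μ : Fin n) :
    dirDeriv v (displacement d μ) = constFun n ((v.1 μ - v.2 μ) • 1) := by
  refine SmoothFun.ext <| funext fun p => ?_
  let l : Pt n × Pt n →L[ℝ] ℝ := ContinuousLinearMap.proj μ ∘L ContinuousLinearMap.fst ℝ _ _ -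
    ContinuousLinearMap.proj μ ∘L ContinuousLinearMap.snd ℝ _ _
  have h : HasFDerivAt (displacement d μ).1 (l.smulRight (1 : MatC d)) p :=
    (l.smulRight (1 : MatC d)).hasFDerivAt
  rw [dirDeriv_apply, h.fderiv]
  simp [l, constFun]

theorem lmul_zero : lmul (0 : SmoothFun n d) = 0 :=
  LinearMap.ext fun _ => SmoothFun.ext <| funext fun _ => zero_mul _

theorem rmul_zero : rmul (0 : SmoothFun n d) = 0 :=
  LinearMap.ext fun _ => SmoothFun.ext <| funext fun _ => mul_zero _

theorem lmul_constFun_smul_one (c : ℝ) : lmul (constFun n (c • (1 : MatC d))) = c • 1 :=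
  LinearMap.ext fun f => SmoothFun.ext <| funext fun p => by simp [lmul_apply, constFun]

/-- The covariant derivative in the first variable with connection form `a`. -/
noncomputable def covDeriv (a : Fin n → SmoothFun n d) (μ : Fin n) : Module.End ℝ (SmoothFun n d) :=
  dirDeriv (Pi.single μ 1, 0) + lmul (a μ)

/-- The dual covariant derivative in the second variable with connection form `a`. -/
noncomputable def covDerivRight (a : Fin n → SmoothFun n d) (μ : Fin n) :
    Module.End ℝ (SmoothFun n d) :=
  dirDeriv (0, Pi.single μ 1) - rmul (a μ)

theorem covDeriv_mul_lmul_const (a : Fin n → SmoothFun n d) (μ : Fin n) {g : MatC d}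
    (h : ∀ p, (a μ).1 p * g = g * (a μ).1 p) :
    covDeriv a μ * lmul (constFun n g) = lmul (constFun n g) * covDeriv a μ := by
  rw [covDeriv, add_mul, mul_add, dirDeriv_mul_lmul, dirDeriv_constFun, lmul_zero, add_zero,
    lmul_comm (a := a μ) h]

theorem covDeriv_mul_rmul_const (a : Fin n → SmoothFun n d) (μ : Fin n) (g : MatC d) :
    covDeriv a μ * rmul (constFun n g) = rmul (constFun n g) * covDeriv a μ := by
  rw [covDeriv, add_mul, mul_add, dirDeriv_mul_rmul, dirDeriv_constFun, rmul_zero, add_zero,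
    lmul_mul_rmul]

theorem lmul_displacement_mul_lmul (μ : Fin n) (a : SmoothFun n d) :
    lmul (displacement d μ) * lmul a = lmul a * lmul (displacement d μ) :=
  lmul_comm fun p => by simp [displacement]

theorem covDeriv_mul_displacement (a : Fin n → SmoothFun n d) (μ ν : Fin n) :
    covDeriv a μ * lmul (displacement d ν) =
      lmul (displacement d ν) * covDeriv a μ + if μ = ν then 1 else 0 := by
  rw [covDeriv, add_mul, mul_add, dirDeriv_mul_lmul, dirDeriv_displacement,
    lmul_constFun_smul_one, lmul_displacement_mul_lmul, add_right_comm]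
  congr 1
  by_cases h : μ = ν <;> simp [h, eq_comm]

theorem covDerivRight_mul_displacement (a : Fin n → SmoothFun n d) (μ ν : Fin n) :
    covDerivRight a μ * lmul (displacement d ν) =
      lmul (displacement d ν) * covDerivRight a μ - if μ = ν then 1 else 0 := by
  rw [covDerivRight, sub_mul, mul_sub, dirDeriv_mul_lmul, dirDeriv_displacement,
    lmul_constFun_smul_one, lmul_mul_rmul]
  by_cases h : μ = ν
  · subst h; simp; abel
  · simp [h, Ne.symm h]

theorem covDerivRight_mul_lmul_const (a : Fin n → SmoothFun n d) (μ : Fin n) (g : MatC d) :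
    covDerivRight a μ * lmul (constFun n g) = lmul (constFun n g) * covDerivRight a μ := by
  rw [covDerivRight, sub_mul, mul_sub, dirDeriv_mul_lmul, dirDeriv_constFun, lmul_zero, add_zero,
    lmul_mul_rmul]

theorem covDeriv_mul_covDerivRight {a b : Fin n → SmoothFun n d} (μ ν : Fin n)
    (ha : dirDeriv (0, Pi.single ν 1) (a μ) = 0) (hb : dirDeriv (Pi.single μ 1, 0) (b ν) = 0) :
    covDeriv a μ * covDerivRight b ν = covDerivRight b ν * covDeriv a μ := by
  simp only [covDeriv, covDerivRight, add_mul, mul_add, sub_mul, mul_sub]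
  rw [dirDeriv_mul_rmul, hb, rmul_zero, add_zero, dirDeriv_mul_lmul, ha, lmul_zero, add_zero,
    lmul_mul_rmul, dirDeriv_comm]
  abel

/-- The commutator of covariant derivatives is multiplication by the curvature. -/
theorem covDeriv_commutator (a : Fin n → SmoothFun n d) (μ ν : Fin n) :
    covDeriv a μ * covDeriv a ν - covDeriv a ν * covDeriv a μ =
      lmul (dirDeriv (Pi.single μ 1, 0) (a ν) - dirDeriv (Pi.single ν 1, 0) (a μ) +
        lmul (a μ) (a ν) - lmul (a ν) (a μ)) := by
  have h : ∀ x y z w : SmoothFun n d, lmul (x - y + z - w) = lmul x - lmul y + lmul z - lmul w :=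
    fun x y z w => LinearMap.ext fun f => SmoothFun.ext <| funext fun p => by
      change (x.1 p - y.1 p + z.1 p - w.1 p) * f.1 p =
        x.1 p * f.1 p - y.1 p * f.1 p + z.1 p * f.1 p - w.1 p * f.1 p
      noncomm_ring
  simp only [covDeriv, add_mul, mul_add, h]
  rw [dirDeriv_mul_lmul, dirDeriv_mul_lmul, dirDeriv_comm, lmul_mul_lmul, lmul_mul_lmul]
  abel

/-- A potential pulled back along the first projection. -/
def pullFst (A : Fin n → Pt n → MatC d) (hA : ∀ μ, ContDiff ℝ (⊤ : ℕ∞) (A μ)) (μ : Fin n) :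
    SmoothFun n d := ⟨fun p => A μ p.1, (hA μ).comp contDiff_fst⟩

/-- A potential pulled back along the second projection. -/
def pullSnd (A : Fin n → Pt n → MatC d) (hA : ∀ μ, ContDiff ℝ (⊤ : ℕ∞) (A μ)) (μ : Fin n) :
    SmoothFun n d := ⟨fun p => A μ p.2, (hA μ).comp contDiff_snd⟩

variable {A : Fin n → Pt n → MatC d} (hA : ∀ μ, ContDiff ℝ (⊤ : ℕ∞) (A μ))

theorem dirDeriv_pullFst (v : Pt n × Pt n) (μ : Fin n) (p : Pt n × Pt n) :
    (dirDeriv v (pullFst A hA μ)).1 p = fderiv ℝ (A μ) p.1 v.1 := by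
  have h := ((hA μ).differentiable (by simp) p.1).hasFDerivAt.comp p
    (hasFDerivAt_fst (𝕜 := ℝ) (p := p))
  have h' : HasFDerivAt (pullFst A hA μ).1 _ p := h
  rw [dirDeriv_apply, h'.fderiv]
  rfl

theorem dirDeriv_pullSnd (v : Pt n × Pt n) (μ : Fin n) (p : Pt n × Pt n) :
    (dirDeriv v (pullSnd A hA μ)).1 p = fderiv ℝ (A μ) p.2 v.2 := by
  have h := ((hA μ).differentiable (by simp) p.2).hasFDerivAt.comp p
    (hasFDerivAt_snd (𝕜 := ℝ) (p := p))
  have h' : HasFDerivAt (pullSnd A hA μ).1 _ p := h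
  rw [dirDeriv_apply, h'.fderiv]
  rfl

theorem sum_end_apply {ι : Type*} (s : Finset ι)
    (Q : ι → Module.End ℝ (SmoothFun n d)) (f : SmoothFun n d) (p : Pt n × Pt n) :
    ((∑ i ∈ s, Q i) f).1 p = ∑ i ∈ s, (Q i f).1 p := by
  rw [LinearMap.sum_apply]
  exact map_sum (SmoothFun.evalAt p) _ s

theorem sum_smul_apply {ι : Type*} (s : Finset ι) (c : ι → ℝ)
    (Q : ι → Module.End ℝ (SmoothFun n d)) (f : SmoothFun n d) (p : Pt n × Pt n) :
    ((∑ i ∈ s, c i • Q i) f).1 p = ∑ i ∈ s, c i • (Q i f).1 p :=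
  sum_end_apply s _ f p

theorem cd_coe (f : SmoothFun n d) (μ : Fin n) :
    cd A μ f.1 = (covDeriv (pullFst A hA) μ f).1 := rfl

theorem dirac_coe (γ : Fin n → MatC d) (f : SmoothFun n d) :
    dirac γ A f.1 =
      (contract eta (fun μ => lmul (constFun n (γ μ))) (covDeriv (pullFst A hA)) f).1 :=
  funext fun p => by rw [contract, sum_smul_apply]; rfl

theorem diracAdj_coe (γ : Fin n → MatC d) (f : SmoothFun n d) :
    diracAdj γ A f.1 =
      ((-contract eta (fun μ => rmul (constFun n (γ μ)))
        (covDerivRight (pullSnd A hA))) f).1 :=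
  funext fun p => by
    change _ = -((contract eta (fun μ => rmul (constFun n (γ μ)))
        (covDerivRight (pullSnd A hA))) f).1 p
    rw [contract, sum_smul_apply]; rfl

theorem euler_coe (f : SmoothFun n d) (p : Pt n × Pt n) :
    ∑ μ, (p.1 μ - p.2 μ) • cd A μ f.1 p =
      ((∑ μ, lmul (displacement d μ) * covDeriv (pullFst A hA) μ) f).1 p := by
  rw [sum_end_apply]
  refine Finset.sum_congr rfl fun μ _ => ?_
  rw [cd_coe hA, Module.End.mul_apply, lmul_apply]
  simp [displacement]

theorem fieldStrength_coe (μ ν : Fin n) (f : SmoothFun n d) (p : Pt n × Pt n) :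
    fieldStrength A μ ν p.1 * f.1 p =
      ((covDeriv (pullFst A hA) μ * covDeriv (pullFst A hA) ν -
        covDeriv (pullFst A hA) ν * covDeriv (pullFst A hA) μ) f).1 p := by
  rw [covDeriv_commutator, lmul_apply]
  change _ = ((dirDeriv _ (pullFst A hA ν)).1 p - (dirDeriv _ (pullFst A hA μ)).1 p +
    A μ p.1 * A ν p.1 - A ν p.1 * A μ p.1) * _
  rw [dirDeriv_pullFst, dirDeriv_pullFst]
  rfl

theorem eta_mul_self (μ : Fin n) : eta μ * eta μ = 1 := by
  unfold eta; split_ifs <;> norm_num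

theorem clifford_lmul {γ : Fin n → MatC d}
    (hγ : ∀ μ ν, γ μ * γ ν + γ ν * γ μ =
      if μ = ν then ((2 : ℝ) * eta μ) • (1 : MatC d) else 0) (μ ν : Fin n) :
    lmul (constFun n (γ μ)) * lmul (constFun n (γ ν)) +
      lmul (constFun n (γ ν)) * lmul (constFun n (γ μ)) =
      if μ = ν then ((2 : ℝ) * eta μ) • (1 : Module.End ℝ (SmoothFun n d)) else 0 := by
  have h : lmul (constFun n (γ μ)) * lmul (constFun n (γ ν)) +
      lmul (constFun n (γ ν)) * lmul (constFun n (γ μ)) =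
      lmul (constFun n (γ μ * γ ν + γ ν * γ μ)) :=
    LinearMap.ext fun f => SmoothFun.ext <| funext fun p => by
      change γ μ * (γ ν * f.1 p) + γ ν * (γ μ * f.1 p) = (γ μ * γ ν + γ ν * γ μ) * f.1 p
      noncomm_ring
  rw [h, hγ]
  split_ifs
  · exact lmul_constFun_smul_one _
  · exact lmul_zero

theorem opP_coe {γ : Fin n → MatC d}
    (hγ : ∀ μ ν, γ μ * γ ν + γ ν * γ μ =
      if μ = ν then ((2 : ℝ) * eta μ) • (1 : MatC d) else 0)
    (hAγ : ∀ μ ν x, A μ x * γ ν = γ ν * A μ x) (f : SmoothFun n d) (p : Pt n × Pt n) :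
    opP γ A f.1 p =
      ((-(contract eta (fun μ => lmul (constFun n (γ μ))) (covDeriv (pullFst A hA)) *
        contract eta (fun μ => lmul (constFun n (γ μ))) (covDeriv (pullFst A hA)))) f).1 p := by
  rw [contract_sq eta_mul_self (clifford_lmul hγ)
    fun μ ν => covDeriv_mul_lmul_const _ μ fun p => hAγ μ ν p.1]
  change _ = -(((_ : Module.End ℝ (SmoothFun n d)) f).1 p +
    (1 / 4 : ℝ) • ((_ : Module.End ℝ (SmoothFun n d)) f).1 p)
  rw [sum_smul_apply, sum_end_apply, neg_add, ← sub_eq_add_neg, opP]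
  refine congrArg₂ _ rfl ?_
  rw [show (1 / 4 : ℂ) = ((1 / 4 : ℝ) : ℂ) by norm_num, Complex.coe_smul]
  refine congrArg _ (Finset.sum_congr rfl fun μ _ => ?_)
  rw [sum_smul_apply]
  refine Finset.sum_congr rfl fun ν _ => congrArg _ ?_
  rw [Module.End.mul_apply, ← fieldStrength_coe hA, mul_assoc]
  congr 1
  change (γ μ * γ ν - γ ν * γ μ) * f.1 p = γ μ * (γ ν * f.1 p) - γ ν * (γ μ * f.1 p)
  noncomm_ring

theorem Ysec_coe (γ : Fin n → MatC d) (k : ℕ) (f g : SmoothFun n d) :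
    Ysec γ A k f.1 g.1 =
      (-((∑ μ, lmul (constFun n (γ μ)) * lmul (displacement d μ)) f -
          (∑ μ, rmul (constFun n (γ μ)) * lmul (displacement d μ)) f) +
        (2 * (k : ℝ)) •
          (contract eta (fun μ => lmul (constFun n (γ μ))) (covDeriv (pullFst A hA)) g -
            (-contract eta (fun μ => rmul (constFun n (γ μ)))
              (covDerivRight (pullSnd A hA))) g)).1 := by
  refine funext fun p => ?_
  rw [Ysec, dirac_coe hA, diracAdj_coe hA]
  change _ = -((_ : SmoothFun n d).1 p - (_ : SmoothFun n d).1 p) + (2 * (k : ℝ)) •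
    ((_ : SmoothFun n d).1 p - (_ : SmoothFun n d).1 p)
  rw [sum_end_apply, sum_end_apply, ← Finset.sum_sub_distrib]
  congr 2
  refine Finset.sum_congr rfl fun μ _ => ?_
  simp [Module.End.mul_apply, lmul_apply, rmul_apply, displacement, constFun, smul_sub]

end Operators

/-- Flat-metric case of the paper's Lemma: if `V_{j−2}, V_{j−1}, V_j` satisfy the Hadamard
transport equations of orders `j − 1` and `j` (with `V_{−1} = 0` when `j = 1`), then
`Y_j` satisfies the transport equation with order shifted by one:
`−2 Σ_μ (x_μ − x'_μ)(∇_μ Y_j) − 2(j−1) Y_j = 2j (P Y_{j−1})`. -/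
theorem stmt_13 {n d : ℕ} (hn : 1 ≤ n) (hd : 1 ≤ d) (j : ℕ) (hj : 1 ≤ j)
    (γ : Fin n → MatC d)
    (hγ : ∀ μ ν, γ μ * γ ν + γ ν * γ μ =
      if μ = ν then ((2 : ℝ) * eta μ) • (1 : MatC d) else 0)
    (A : Fin n → Pt n → MatC d) (hA : ∀ μ, ContDiff ℝ (⊤ : ℕ∞) (A μ))
    (hAγ : ∀ μ ν x, A μ x * γ ν = γ ν * A μ x)
    (Vjm2 Vjm1 Vj : Pt n × Pt n → MatC d)
    (hVjm2 : ContDiff ℝ (⊤ : ℕ∞) Vjm2) (hVjm1 : ContDiff ℝ (⊤ : ℕ∞) Vjm1) (hVj : ContDiff ℝ (⊤ : ℕ∞) Vj)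
    (hVm1 : j = 1 → Vjm2 = 0)
    (htrans1 : TransportEq γ A (j - 1) Vjm1 Vjm2)
    (htrans2 : TransportEq γ A j Vj Vjm1) :
    ∀ p : Pt n × Pt n,
      (-2 : ℝ) • ∑ μ, (p.1 μ - p.2 μ) • cd A μ (Ysec γ A j Vj Vjm1) p -
          (2 * ((j : ℝ) - 1)) • Ysec γ A j Vj Vjm1 p =
        (2 * (j : ℝ)) • opP γ A (Ysec γ A (j - 1) Vjm1 Vjm2) p := by
  obtain ⟨Vjm2, rfl⟩ : ∃ f : SmoothFun n d, f.1 = Vjm2 := ⟨⟨_, hVjm2⟩, rfl⟩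
  obtain ⟨Vjm1, rfl⟩ : ∃ f : SmoothFun n d, f.1 = Vjm1 := ⟨⟨_, hVjm1⟩, rfl⟩
  obtain ⟨Vj, rfl⟩ : ∃ f : SmoothFun n d, f.1 = Vj := ⟨⟨_, hVj⟩, rfl⟩
  have hc : ((j - 1 : ℕ) : ℝ) = (j : ℝ) - 1 := by push_cast [hj]; ring
  have hNL : ∀ μ ν, covDeriv (pullFst A hA) μ * lmul (constFun n (γ ν)) =
      lmul (constFun n (γ ν)) * covDeriv (pullFst A hA) μ :=
    fun μ ν => covDeriv_mul_lmul_const _ μ fun p => hAγ μ ν p.1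
  have hNR : ∀ μ ν, covDeriv (pullFst A hA) μ * rmul (constFun n (γ ν)) =
      rmul (constFun n (γ ν)) * covDeriv (pullFst A hA) μ :=
    fun μ ν => covDeriv_mul_rmul_const _ μ _
  have hXL : ∀ μ ν, lmul (displacement d μ) * lmul (constFun n (γ ν)) =
      lmul (constFun n (γ ν)) * lmul (displacement d μ) :=
    fun μ ν => lmul_displacement_mul_lmul μ _
  have hXR : ∀ μ ν, lmul (displacement d μ) * rmul (constFun n (γ ν)) =
      rmul (constFun n (γ ν)) * lmul (displacement d μ) := fun μ ν => lmul_mul_rmul _ _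
  have hXX : ∀ μ ν : Fin n, lmul (displacement d μ) * lmul (displacement d ν) =
      lmul (displacement d ν) * lmul (displacement d μ) :=
    fun μ ν => lmul_displacement_mul_lmul μ _
  have hLR : ∀ μ ν, lmul (constFun n (γ μ)) * rmul (constFun n (γ ν)) =
      rmul (constFun n (γ ν)) * lmul (constFun n (γ μ)) := fun μ ν => lmul_mul_rmul _ _
  have hNN' : ∀ μ ν, covDeriv (pullFst A hA) μ * covDerivRight (pullSnd A hA) ν =
      covDerivRight (pullSnd A hA) ν * covDeriv (pullFst A hA) μ := fun μ ν =>
    covDeriv_mul_covDerivRight μ ν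
      (SmoothFun.ext <| funext fun p => by rw [dirDeriv_pullFst]; simp)
      (SmoothFun.ext <| funext fun p => by rw [dirDeriv_pullSnd]; simp)
  have hL := clifford_lmul hγ
  have hNX := covDeriv_mul_displacement (pullFst A hA)
  have key := transport_shift (n : ℝ) (j : ℝ)
    (by simpa using contract_anticomm_position eta_mul_self hL hNL hXL hNX)
    (euler_mul_position hNL hXL hXX hNX) (euler_mul_position hNR hXR hXX hNX)
    (contract_mul_position (η := eta) hNR hLR hXL hNX)
    (contract_anticomm_contract eta_mul_self hL hNL hNR hLR)
    (Q := -contract eta (fun μ => rmul (constFun n (γ μ))) (covDerivRight (pullSnd A hA)))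
    (by
      rw [mul_neg, contract_mul_euler hNR hXR hNN'
        (covDerivRight_mul_displacement (pullSnd A hA)), neg_add, neg_mul, sub_eq_add_neg])
    (by
      rw [mul_neg, neg_mul, contract_commute_contract hNR hLR hNN'
        fun μ ν => covDerivRight_mul_lmul_const _ μ _])
    rfl (u := Vjm2) (w := Vjm1) (v := Vj)
    (SmoothFun.ext <| funext fun p => by
      have h := htrans1 p
      rw [euler_coe hA, opP_coe hA hγ hAγ, hc] at h
      exact h)
    (SmoothFun.ext <| funext fun p => by
      have h := htrans2 p
      rw [euler_coe hA, opP_coe hA hγ hAγ] at h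
      exact h)
  intro p
  rw [Ysec_coe hA, Ysec_coe hA, euler_coe hA, opP_coe hA hγ hAγ, hc]
  exact congrFun (congrArg SmoothFun.val key) p

end FlatChiral
end

section
/- Let k > 0 be a real number, W : ℝⁿ × ℝⁿ → E a smooth function, and B_μ : ℝⁿ × ℝⁿ → (E →L[ℝ] E), for μ = 0, …, n−1, continuous maps. Suppose that for all x, x' ∈ ℝⁿ: Σ_μ (x_μ − x'_μ)·((∂_{x_μ}W)(x,x') + B_μ(x,x')(W(x,x'))) = −k·W(x,x'). Then W is identically zero. (This uniqueness statement for the homogeneous flat-space transport equation along the geodesics emanating from the diagonal is what allows the paper to conclude, from the transport-equation Lemma, that all sections Y_j with j ≥ 2 vanish identically.) -/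
open Filter

/-- A regular singular linear ODE `t f' + t A f = -k f` with `k > 0` has no nonzero solution that
stays regular at `t = 0`. -/
theorem eq_zero_of_smul_deriv_add_eq_neg_smul {E : Type*} [NormedAddCommGroup E] [NormedSpace ℝ E]
    {k : ℝ} (hk : 0 < k) {f f' : ℝ → E} {A : ℝ → (E →L[ℝ] E)}
    (hf : ∀ t, HasDerivAt f (f' t) t) (hA : ContinuousOn A (Set.Icc 0 1))
    (h : ∀ t, t • (f' t + A t (f t)) = -k • f t) : f 1 = 0 := by
  obtain ⟨C, hC⟩ := isCompact_Icc.exists_bound_of_continuousOn hA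
  have hfc : Continuous f := continuous_iff_continuousAt.2 fun t => (hf t).continuousAt
  have hg : Continuous fun t : ℝ => t ^ k • f t :=
    (Real.continuous_rpow_const hk.le).smul hfc
  have hg' : ∀ t : ℝ, 0 < t →
      HasDerivAt (fun t : ℝ => t ^ k • f t) (-A t (t ^ k • f t)) t := by
    intro t ht
    have ht' : t ^ k = t ^ (k - 1) * t := by
      rw [Real.rpow_sub_one ht.ne', div_mul_cancel₀ _ ht.ne']
    have key := congrArg (fun v => t ^ (k - 1) • v) (h t)
    simp only [smul_add, smul_smul, ← ht', neg_smul, smul_neg] at key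
    refine ((Real.hasDerivAt_rpow_const (p := k) (Or.inl ht.ne')).smul (hf t)).congr_deriv ?_
    rw [map_smul, eq_neg_iff_add_eq_zero, mul_comm k, add_right_comm, key, neg_add_cancel]
  have hbound : ∀ ε ∈ Set.Ioo (0 : ℝ) 1,
      ‖f 1‖ ≤ ‖ε ^ k • f ε‖ * Real.exp (C * (1 - ε)) := by
    intro ε hε
    have := norm_le_gronwallBound_of_norm_deriv_right_le (K := C) (ε := 0) (a := ε) (b := 1)
      hg.continuousOn (fun t ht => (hg' t (hε.1.trans_le ht.1)).hasDerivWithinAt) le_rfl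
      (fun t ht => by
        rw [norm_neg, add_zero]
        exact (A t).le_of_opNorm_le (hC t ⟨hε.1.le.trans ht.1, ht.2.le⟩) _)
      1 (Set.right_mem_Icc.2 hε.2.le)
    simpa [gronwallBound_ε0] using this
  have hlim : Tendsto (fun ε : ℝ => ‖ε ^ k • f ε‖ * Real.exp (C * (1 - ε)))
      (nhdsWithin 0 (Set.Ioi 0)) (nhds 0) := by
    have hcont : Continuous fun ε : ℝ => ‖ε ^ k • f ε‖ * Real.exp (C * (1 - ε)) :=
      hg.norm.mul (by fun_prop)
    simpa [Real.zero_rpow hk.ne'] using (hcont.tendsto 0).mono_left nhdsWithin_le_nhds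
  refine norm_le_zero_iff.1 (ge_of_tendsto hlim ?_)
  filter_upwards [Ioo_mem_nhdsGT (zero_lt_one' ℝ)] with ε hε using hbound ε hε

/-- Uniqueness for the homogeneous flat-space transport equation of positive order:
if a smooth `W : ℝⁿ × ℝⁿ → E` satisfies
`Σ_μ (x_μ − x'_μ) (∂_{x_μ}W + B_μ(x,x')(W)) = −k W` with `k > 0` and continuous `B_μ`,
then `W ≡ 0`. -/
theorem stmt_14 {n : ℕ} (hn : 1 ≤ n)
    {E : Type*} [NormedAddCommGroup E] [NormedSpace ℝ E] [FiniteDimensional ℝ E]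
    (k : ℝ) (hk : 0 < k)
    (W : (Fin n → ℝ) × (Fin n → ℝ) → E) (hW : ContDiff ℝ (⊤ : ℕ∞) W)
    (B : Fin n → ((Fin n → ℝ) × (Fin n → ℝ)) → (E →L[ℝ] E))
    (hB : ∀ μ, Continuous (B μ))
    (heq : ∀ p : (Fin n → ℝ) × (Fin n → ℝ),
      ∑ μ, (p.1 μ - p.2 μ) •
          (fderiv ℝ W p (Pi.single μ 1, 0) + B μ p (W p)) = -k • W p) :
    W = 0 := by
  funext p
  obtain ⟨x, y⟩ := p
  have hγ : ∀ t : ℝ, HasDerivAt (fun t : ℝ => (y + t • (x - y), y)) (x - y, 0) t := fun t => by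
    simpa using (((hasDerivAt_id t).smul_const (x - y)).const_add y).prodMk (hasDerivAt_const t y)
  have hγc : Continuous fun t : ℝ => (y + t • (x - y), y) := by fun_prop
  have hsum : ∀ p, fderiv ℝ W p (x - y, 0)
      = ∑ μ, (x μ - y μ) • fderiv ℝ W p (Pi.single μ 1, 0) := fun p => by
    have hv : ((x - y, 0) : (Fin n → ℝ) × (Fin n → ℝ))
        = ∑ μ, (x μ - y μ) • ((Pi.single μ 1, 0) : (Fin n → ℝ) × (Fin n → ℝ)) := by
      refine Prod.ext ?_ ?_
      · simpa [Prod.fst_sum] using pi_eq_sum_univ' (x - y)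
      · simp [Prod.snd_sum]
    rw [hv, map_sum]
    simp only [map_smul]
  have hderiv : ∀ t : ℝ, HasDerivAt (fun t : ℝ => W (y + t • (x - y), y))
      (fderiv ℝ W (y + t • (x - y), y) (x - y, 0)) t := fun t =>
    ((hW.differentiable (by simp)) _).hasFDerivAt.comp_hasDerivAt t (hγ t)
  have hA : Continuous fun t : ℝ => ∑ μ, (x μ - y μ) • B μ (y + t • (x - y), y) :=
    continuous_finsetSum _ fun μ _ => ((hB μ).comp hγc).const_smul (x μ - y μ)
  have key := eq_zero_of_smul_deriv_add_eq_neg_smul hk hderiv hA.continuousOn fun t => by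
    rw [← heq, hsum]
    simp [← Finset.sum_add_distrib, Finset.smul_sum, smul_smul]
  simpa using key
end

section
/- Let W : ℝⁿ × ℝⁿ → E be a smooth function vanishing on the diagonal, i.e. W(x', x') = 0 for all x' ∈ ℝⁿ, and let B_μ : ℝⁿ × ℝⁿ → (E →L[ℝ] E), for μ = 0, …, n−1, be continuous maps. Suppose that for all x, x' ∈ ℝⁿ: Σ_μ (x_μ − x'_μ)·((∂_{x_μ}W)(x,x') + B_μ(x,x')(W(x,x'))) = 0. Then W is identically zero. (This uniqueness statement for the order-zero homogeneous flat-space transport equation is what allows the paper to conclude that Y_1 vanishes identically from the transport equation together with the coinciding point limit [Y_1] = 0.) -/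
open Filter

/-- A solution of a homogeneous linear ODE with continuous coefficient that vanishes at `0`
vanishes at `1`. -/
theorem eq_zero_of_hasDerivAt_linear {E : Type*} [NormedAddCommGroup E] [NormedSpace ℝ E]
    {g : ℝ → E} {A : ℝ → E →L[ℝ] E} (hA : Continuous A)
    (hg : ∀ t, HasDerivAt g (A t (g t)) t) (h0 : g 0 = 0) : g 1 = 0 := by
  obtain ⟨K, hK⟩ := (isCompact_Icc (a := (0 : ℝ)) (b := 1)).exists_bound_of_continuousOn
    hA.continuousOn
  have hcont : Continuous g := continuous_iff_continuousAt.2 fun t => (hg t).continuousAt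
  exact eq_zero_of_abs_deriv_le_mul_abs_self_of_eq_zero_right (K := K) hcont.continuousOn
    (fun t _ => (hg t).hasDerivWithinAt) h0
    (fun t ht => (A t).le_of_opNorm_le (hK t ⟨ht.1, ht.2.le⟩) (g t)) 1 (by simp)

/-- A vector in the first factor, expanded in the coordinate directions of that factor. -/
theorem sum_smul_single_prod_zero {n : ℕ} (v : Fin n → ℝ) :
    ∑ μ, v μ • ((Pi.single μ 1, 0) : (Fin n → ℝ) × (Fin n → ℝ)) = (v, 0) := by
  ext i
  · simp [Prod.fst_sum, Finset.sum_apply, Pi.single_apply]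
  · simp [Prod.snd_sum]

/-- Uniqueness for the order-zero homogeneous flat-space transport equation:
if a smooth `W : ℝⁿ × ℝⁿ → E` vanishes on the diagonal and satisfies
`Σ_μ (x_μ − x'_μ) (∂_{x_μ}W + B_μ(x,x')(W)) = 0` with continuous `B_μ`, then `W ≡ 0`. -/
theorem stmt_15 {n : ℕ} (hn : 1 ≤ n)
    {E : Type*} [NormedAddCommGroup E] [NormedSpace ℝ E] [FiniteDimensional ℝ E]
    (W : (Fin n → ℝ) × (Fin n → ℝ) → E) (hW : ContDiff ℝ (⊤ : ℕ∞) W)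
    (hdiag : ∀ x' : Fin n → ℝ, W (x', x') = 0)
    (B : Fin n → ((Fin n → ℝ) × (Fin n → ℝ)) → (E →L[ℝ] E))
    (hB : ∀ μ, Continuous (B μ))
    (heq : ∀ p : (Fin n → ℝ) × (Fin n → ℝ),
      ∑ μ, (p.1 μ - p.2 μ) •
          (fderiv ℝ W p (Pi.single μ 1, 0) + B μ p (W p)) = 0) :
    W = 0 := by
  have hW1 : ContDiff ℝ 1 W := hW.of_le (by exact_mod_cast le_top)
  funext ⟨x, y⟩
  let v : Fin n → ℝ := x - y
  let γ : ℝ → (Fin n → ℝ) × (Fin n → ℝ) := fun t => (y + t • v, y)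
  have hγ : ∀ t, HasDerivAt γ (v, 0) t := fun t =>
    (by simpa using ((hasDerivAt_id t).smul_const v).const_add y :
      HasDerivAt (fun t : ℝ => y + t • v) v t).prodMk (hasDerivAt_const t y)
  have hγc : Continuous γ := by fun_prop
  let A : ℝ → E →L[ℝ] E := fun t => -∑ μ, v μ • B μ (γ t)
  have hA : Continuous A :=
    (continuous_finsetSum _ fun μ _ => ((hB μ).comp hγc).const_smul (v μ)).neg
  have hderiv : (fun t => fderiv ℝ W (γ t) (v, 0)) = fun t => A t (W (γ t)) := by
    refine Continuous.ext_on (dense_compl_singleton (0 : ℝ)) ?_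
      (hA.clm_apply (hW.continuous.comp hγc)) fun t ht => ?_
    · exact ((hW1.continuous_fderiv one_ne_zero).comp hγc).clm_apply continuous_const
    · have h : t • (∑ μ, v μ • (fderiv ℝ W (γ t) (Pi.single μ 1, 0) + B μ (γ t) (W (γ t)))) = 0 := by
        simpa [γ, Finset.smul_sum, mul_smul] using heq (γ t)
      have h' := (smul_eq_zero.1 h).resolve_left ht
      simp only [smul_add, Finset.sum_add_distrib, ← map_smul (fderiv ℝ W (γ t)), ← map_sum,
        sum_smul_single_prod_zero] at h'
      simpa [A] using eq_neg_of_add_eq_zero_left h'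
  have hg : ∀ t, HasDerivAt (fun t => W (γ t)) (A t (W (γ t))) t := fun t => by
    have h := (hW1.differentiable one_ne_zero (γ t)).hasFDerivAt.comp_hasDerivAt t (hγ t)
    rwa [congrFun hderiv t] at h
  simpa [γ, v] using eq_zero_of_hasDerivAt_linear hA hg (by simpa [γ] using hdiag y)
end
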